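/- Let u = (0,1), let m be the minimum cardinality of a cover, and suppose Z ⊆ ℤ²∖H_u is a set of minimum cardinality among sets satisfying both |Z| < s² + s + m and Z̄ = [H_u ∪ Z]∖H_u infinite (for the update family 𝒰_S), and suppose moreover that W ⊆ Z (i.e., the unique translate p + W contained in Z has p = (0,0)). Then there is no q ∈ ℤ²∖{(0,0)} such that q + W ⊆ Z̄. -/

import Mathlib

open scoped Classical

/-- A site of the two-dimensional lattice. -/
abbrev Site : Type := ℤ × ℤ

/-- An update family: a finite nonempty collection of finite nonempty rules,
none containing the origin. We represent the collection as a `Finset (Finset Site)`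
together with this well-formedness predicate. -/
def IsUpdateFamily (𝒰 : Finset (Finset Site)) : Prop :=
  𝒰.Nonempty ∧ ∀ U ∈ 𝒰, U.Nonempty ∧ ((0, 0) : Site) ∉ U

/-- One step of the bootstrap percolation dynamics. -/
def bpStep (𝒰 : Finset (Finset Site)) (A : Set Site) : Set Site :=
  A ∪ {x : Site | ∃ U ∈ 𝒰, ∀ y ∈ U, x + y ∈ A}

/-- The configuration after `t` steps of the dynamics started from `A`. -/
def bpIter (𝒰 : Finset (Finset Site)) (A : Set Site) : ℕ → Set Site
  | 0 => A
  | n + 1 => bpStep 𝒰 (bpIter 𝒰 A n)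

/-- The closure `[A]` of a set `A` under the bootstrap dynamics. -/
def bpClosure (𝒰 : Finset (Finset Site)) (A : Set Site) : Set Site :=
  ⋃ n : ℕ, bpIter 𝒰 A n

/-- The unit circle `S¹ ⊆ ℝ²`. -/
def sphere2 : Set (ℝ × ℝ) := {u : ℝ × ℝ | u.1 ^ 2 + u.2 ^ 2 = 1}

/-- Inner product of a lattice site with a real vector. -/
def inner2 (x : Site) (u : ℝ × ℝ) : ℝ := (x.1 : ℝ) * u.1 + (x.2 : ℝ) * u.2

/-- The open half-plane `H_u` with outer normal `u`. -/
def halfPlane (u : ℝ × ℝ) : Set Site := {x : Site | inner2 x u < 0}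

/-- The lattice line `l_u` through the origin perpendicular to `u`. -/
def lineu (u : ℝ × ℝ) : Set Site := {x : Site | inner2 x u = 0}

/-- A direction `u` is unstable if some rule lies in `H_u`. -/
def Unstable (𝒰 : Finset (Finset Site)) (u : ℝ × ℝ) : Prop :=
  ∃ U ∈ 𝒰, (U : Set Site) ⊆ halfPlane u

/-- A direction of the unit circle is stable if it is not unstable. -/
def Stable (𝒰 : Finset (Finset Site)) (u : ℝ × ℝ) : Prop :=
  u ∈ sphere2 ∧ ¬ Unstable 𝒰 u

/-- The set of stable directions. -/
def stableSet (𝒰 : Finset (Finset Site)) : Set (ℝ × ℝ) := {u | Stable 𝒰 u}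

/-- An isolated stable direction: a stable direction not in the (topological)
closure of the set of other stable directions. -/
def IsolatedStable (𝒰 : Finset (Finset Site)) (u : ℝ × ℝ) : Prop :=
  Stable 𝒰 u ∧ u ∉ closure (stableSet 𝒰 \ {u})

/-- The open semicircle of the unit circle centred at the direction `v`. -/
def openSemicircle (v : ℝ × ℝ) : Set (ℝ × ℝ) :=
  {u ∈ sphere2 | 0 < u.1 * v.1 + u.2 * v.2}

/-- A family is supercritical if some open semicircle consists of unstable directions. -/
def Supercritical (𝒰 : Finset (Finset Site)) : Prop :=
  ∃ v ∈ sphere2, ∀ u ∈ openSemicircle v, Unstable 𝒰 u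

/-- A family is critical if it is not supercritical and some open semicircle
contains only finitely many stable directions. -/
def Critical (𝒰 : Finset (Finset Site)) : Prop :=
  ¬ Supercritical 𝒰 ∧ ∃ v ∈ sphere2, (stableSet 𝒰 ∩ openSemicircle v).Finite

/-- The difficulty `α(u)` of a direction: `0` for unstable directions, `∞` for
non-isolated stable directions, and for isolated stable directions the minimum
cardinality of a finite `Z ⊆ ℤ² ∖ H_u` such that `[H_u ∪ Z] ∖ H_u` is infinite. -/
noncomputable def dirDifficulty (𝒰 : Finset (Finset Site)) (u : ℝ × ℝ) : ℕ∞ :=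
  if Unstable 𝒰 u then 0
  else if IsolatedStable 𝒰 u then
    sInf {n : ℕ∞ | ∃ Z : Finset Site, (∀ z ∈ Z, z ∉ halfPlane u) ∧
      (bpClosure 𝒰 (halfPlane u ∪ (Z : Set Site)) \ halfPlane u).Infinite ∧ n = Z.card}
  else ⊤

/-- The difficulty `α(𝒰)` of an update family. -/
noncomputable def difficulty (𝒰 : Finset (Finset Site)) : ℕ∞ :=
  ⨅ v ∈ sphere2, ⨆ u ∈ openSemicircle v, dirDifficulty 𝒰 u

/-- The diameter `D` of an update family: `2 · max{‖x‖_∞ : x ∈ ⋃ U ∈ 𝒰, U}`. -/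
def famDiam (𝒰 : Finset (Finset Site)) : ℕ :=
  2 * 𝒰.sup (fun U => U.sup (fun x => max x.1.natAbs x.2.natAbs))

/-- The set `W = {(x,0) : 1 ≤ x ≤ s²} ∪ {(l·s,1) : 1 ≤ l ≤ s}`. -/
noncomputable def Wset (s : ℕ) : Finset Site :=
  (Finset.Icc 1 (s ^ 2)).image (fun x => ((x : ℤ), (0 : ℤ))) ∪
    (Finset.Icc 1 s).image (fun l => (((l * s : ℕ) : ℤ), (1 : ℤ)))

/-- The set `T = {(0,−y) : 1 ≤ y ≤ N·s²}`. -/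
noncomputable def Tset (N s : ℕ) : Finset Site :=
  (Finset.Icc 1 (N * s ^ 2)).image (fun y => ((0 : ℤ), -(y : ℤ)))

/-- The rule `U₀ = {(−k,0) : 1 ≤ k ≤ N·s²} ∪ {(0,−k) : 1 ≤ k ≤ N·s²}`. -/
noncomputable def Urule0 (N s : ℕ) : Finset Site :=
  (Finset.Icc 1 (N * s ^ 2)).image (fun k => (-(k : ℤ), (0 : ℤ))) ∪
    (Finset.Icc 1 (N * s ^ 2)).image (fun k => ((0 : ℤ), -(k : ℤ)))

/-- The rule `U₁ = {(k,0) : 1 ≤ k ≤ N·s²} ∪ {(0,−k) : 1 ≤ k ≤ N·s²}`. -/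
noncomputable def Urule1 (N s : ℕ) : Finset Site :=
  (Finset.Icc 1 (N * s ^ 2)).image (fun k => ((k : ℤ), (0 : ℤ))) ∪
    (Finset.Icc 1 (N * s ^ 2)).image (fun k => ((0 : ℤ), -(k : ℤ)))

/-- The rule `U_{i,j}^k = T ∪ ((W ∪ {(i·s,2)}) − (k+(N+j)·s², 0))`. -/
noncomputable def Uijk (N s i j k : ℕ) : Finset Site :=
  Tset N s ∪
    (Wset s ∪ {(((i * s : ℕ) : ℤ), (2 : ℤ))}).image
      (fun w => w - (((k + (N + j) * s ^ 2 : ℕ) : ℤ), (0 : ℤ)))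

/-- The update family `𝒰_S = {U₀,U₁} ∪ {U_{i,j}^k : 1 ≤ i ≤ s, j ∈ S_i, 1 ≤ k ≤ s²}`
associated to a set cover instance `S`. -/
noncomputable def famS (N s : ℕ) (S : ℕ → Finset ℕ) : Finset (Finset Site) :=
  {Urule0 N s, Urule1 N s} ∪
    (((Finset.Icc 1 s ×ˢ Finset.Icc 1 N ×ˢ Finset.Icc 1 (s ^ 2)).filter
        (fun t => t.2.1 ∈ S t.1)).image (fun t => Uijk N s t.1 t.2.1 t.2.2))

/-- `M` is a cover of the set cover instance `S_1, …, S_s` over `{1,…,N}`. -/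
def IsCover (N s : ℕ) (S : ℕ → Finset ℕ) (M : Finset ℕ) : Prop :=
  M ⊆ Finset.Icc 1 s ∧ M.biUnion S = Finset.Icc 1 N

/-- The half-plane below the axis, the set `Z`, and all the blocks of the axis that a copy of `W`
at the origin can infect except the one with index `j₀`. -/
def barrier (N s : ℕ) (Z : Finset Site) (j₀ : ℤ) : Set Site :=
  {p | p.2 < 0 ∨ p ∈ Z ∨ (p.2 = 0 ∧ ∃ j : ℤ, 1 ≤ j ∧ j ≤ N ∧ j ≠ j₀ ∧
    (N + j) * (s : ℤ) ^ 2 < p.1 ∧ p.1 ≤ (N + j) * (s : ℤ) ^ 2 + (s : ℤ) ^ 2)}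

lemma mem_natCast_lift {t : Finset ℕ} {z : ℤ} :
    z ∈ (do let a ← t; pure (a : ℤ) : Finset ℤ) ↔ ∃ n ∈ t, (n : ℤ) = z := by
  simp

lemma mem_Wset {s : ℕ} {p : Site} :
    p ∈ Wset s ↔ (p.2 = 0 ∧ 1 ≤ p.1 ∧ p.1 ≤ (s : ℤ) ^ 2) ∨
      (p.2 = 1 ∧ ∃ l : ℤ, 1 ≤ l ∧ l ≤ s ∧ p.1 = l * s) := by
  obtain ⟨x, y⟩ := p
  simp only [Wset, Finset.mem_union, Finset.mem_image, mem_natCast_lift, Finset.mem_Icc,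
    Prod.mk.injEq]
  constructor
  · rintro (⟨_, ⟨k, ⟨h1, h2⟩, rfl⟩, rfl, rfl⟩ | ⟨l, ⟨h1, h2⟩, rfl, rfl⟩)
    · exact Or.inl ⟨rfl, by exact_mod_cast h1, by exact_mod_cast h2⟩
    · exact Or.inr ⟨rfl, l, by exact_mod_cast h1, by exact_mod_cast h2, by push_cast; rfl⟩
  · rintro (⟨rfl, h1, h2⟩ | ⟨rfl, l, h1, h2, rfl⟩)
    · lift x to ℕ using by omega
      exact Or.inl ⟨x, ⟨x, ⟨by exact_mod_cast h1, by exact_mod_cast h2⟩, rfl⟩, rfl, rfl⟩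
    · lift l to ℕ using by omega
      exact Or.inr ⟨l, ⟨by exact_mod_cast h1, by exact_mod_cast h2⟩, by push_cast; rfl, rfl⟩

lemma mem_halfPlane_up {p : Site} : p ∈ halfPlane ((0 : ℝ), (1 : ℝ)) ↔ p.2 < 0 := by
  simp [halfPlane, inner2]

lemma card_Wset {s : ℕ} (hs : 0 < s) : (Wset s).card = s ^ 2 + s := by
  rw [Wset, Finset.card_union_of_disjoint, Finset.card_image_of_injective,
    Finset.card_image_of_injective]
  · simp [Finset.card_image_of_injective _ Nat.cast_injective]
  · intro a b h
    simp only [Prod.mk.injEq, and_true] at h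
    exact Nat.eq_of_mul_eq_mul_right hs (by exact_mod_cast h)
  · intro a b h
    simpa using h
  · rw [Finset.disjoint_left]
    simp only [Finset.mem_image]
    rintro p ⟨x, -, rfl⟩ ⟨l, -, h⟩
    simp at h

lemma bpClosure_subset {𝒰 : Finset (Finset Site)} {A B : Set Site} (hAB : A ⊆ B)
    (hB : ∀ x, ∀ U ∈ 𝒰, (∀ y ∈ U, x + y ∈ B) → x ∈ B) : bpClosure 𝒰 A ⊆ B := by
  refine Set.iUnion_subset fun n => ?_
  induction n with
  | zero => exact hAB
  | succ n ih =>
    rintro x (hx | ⟨U, hU, hx⟩)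
    · exact ih hx
    · exact hB x U hU fun y hy => ih (hx y hy)

/-- If `Z` has fewer than `s` sites outside `W`, no sequence of `s` distinct sites of `Z`
avoids `W`. -/
lemma false_of_extra_sites {s : ℕ} {Z : Finset Site} (hE : (Z \ Wset s).card < s)
    (f : ℕ → Site) (hf : Function.Injective f)
    (hZ : ∀ n < s, f n ∈ Z) (hW : ∀ n < s, f n ∉ Wset s) : False := by
  have h : ((Finset.range s).image f).card ≤ (Z \ Wset s).card := by
    refine Finset.card_le_card fun p hp => ?_
    obtain ⟨n, hn, rfl⟩ := Finset.mem_image.1 hp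
    have hn := Finset.mem_range.1 hn
    exact Finset.mem_sdiff.2 ⟨hZ n hn, hW n hn⟩
  rw [Finset.card_image_of_injective _ hf, Finset.card_range] at h
  omega

lemma not_segment_subset_of_pos {s : ℕ} (hs : 4 ≤ s) {Z : Finset Site}
    (hE : (Z \ Wset s).card < s) {c b : ℤ} (hb : 1 ≤ b)
    (h : ∀ x : ℤ, 1 ≤ x → x ≤ (s : ℤ) ^ 2 → ((c + x, b) : Site) ∈ Z) : False := by
  have hsub : (Finset.Icc 1 (s ^ 2)).image (fun k : ℕ => ((c + k, b) : Site)) ⊆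
      (Z \ Wset s) ∪ (Finset.Icc 1 s).image (fun l => (((l * s : ℕ) : ℤ), (1 : ℤ))) := by
    intro p hp
    obtain ⟨k, hk, rfl⟩ := Finset.mem_image.1 hp
    rw [Finset.mem_Icc] at hk
    have hkZ := h k (by exact_mod_cast hk.1) (by exact_mod_cast hk.2)
    by_cases hkW : ((c + k, b) : Site) ∈ Wset s
    · rcases Finset.mem_union.1 hkW with hk0 | hk1
      · obtain ⟨x, -, hx⟩ := Finset.mem_image.1 hk0
        simp only [Prod.mk.injEq] at hx
        omega
      · exact Finset.mem_union_right _ hk1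
    · exact Finset.mem_union_left _ (Finset.mem_sdiff.2 ⟨hkZ, hkW⟩)
  have h1 := (Finset.card_le_card hsub).trans (Finset.card_union_le _ _)
  rw [Finset.card_image_of_injective _ (fun a b h => by simpa using h), Nat.card_Icc] at h1
  have h2 : ((Finset.Icc 1 s).image (fun l => (((l * s : ℕ) : ℤ), (1 : ℤ)))).card ≤ s :=
    Finset.card_image_le.trans (by simp)
  have h3 : 4 * s ≤ s ^ 2 := by nlinarith
  omega

/-- A row of `s` consecutive sites of the axis lying in the barrier meets `W` or a block. -/
lemma false_of_axis_gap {N s : ℕ} {Z : Finset Site} {j₀ : ℤ} (hE : (Z \ Wset s).card < s)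
    (d : ℤ) (hd : ∀ x, d < x → x ≤ d + s → ((x, 0) : Site) ∈ barrier N s Z j₀)
    (hdW : d + s ≤ 0 ∨ (s : ℤ) ^ 2 ≤ d)
    (hdB : ∀ j : ℤ, 1 ≤ j → j ≤ N → j ≠ j₀ →
      d + s ≤ (N + j) * (s : ℤ) ^ 2 ∨ (N + j) * (s : ℤ) ^ 2 + (s : ℤ) ^ 2 ≤ d) : False := by
  refine false_of_extra_sites hE (fun n => (d + 1 + n, 0)) (fun a b h => by simpa using h) ?_ ?_
  · intro n hn
    rcases hd (d + 1 + n) (by omega) (by omega) with h | h | ⟨-, j, h1, h2, h3, h4, h5⟩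
    · simp at h
    · exact h
    · simp only at h4 h5
      rcases hdB j h1 h2 h3 with h | h <;> omega
  · intro n hn h
    rcases mem_Wset.1 h with ⟨-, h1, h2⟩ | ⟨h1, -⟩
    · simp only at h1 h2
      rcases hdW with h | h <;> omega
    · simp at h1

lemma mem_of_mem_barrier {N s : ℕ} {Z : Finset Site} {j₀ : ℤ} {p : Site}
    (hp : p ∈ barrier N s Z j₀) (hp2 : 0 < p.2) : p ∈ Z := by
  rcases hp with h | h | ⟨h, -⟩
  · omega
  · exact h
  · omega

lemma not_segment_subset_barrier {N s : ℕ} (hN : 4 ≤ N) (hs : 4 ≤ s) {Z : Finset Site}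
    (hE : (Z \ Wset s).card < s) {j₀ : ℤ} (hj₁ : 1 ≤ j₀) (hj₂ : j₀ ≤ N) {c b : ℤ} (hb : 0 ≤ b)
    (h : ∀ x : ℤ, 1 ≤ x → x ≤ N * (s : ℤ) ^ 2 → ((c + x, b) : Site) ∈ barrier N s Z j₀) :
    False := by
  have hsL : 4 * (s : ℤ) ≤ (s : ℤ) ^ 2 := by nlinarith
  have hNL : 4 * (s : ℤ) ^ 2 ≤ N * (s : ℤ) ^ 2 := by
    gcongr; exact_mod_cast hN
  have hs' : (4 : ℤ) ≤ s := by exact_mod_cast hs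
  rcases hb.eq_or_lt with rfl | hb
  · have hseg : ∀ d, c ≤ d → d + s ≤ c + N * (s : ℤ) ^ 2 →
        ∀ x, d < x → x ≤ d + s → ((x, 0) : Site) ∈ barrier N s Z j₀ := by
      intro d h1 h2 x h3 h4
      have := h (x - c) (by omega) (by omega)
      rwa [add_sub_cancel] at this
    generalize hL : (s : ℤ) ^ 2 = L at *
    have hmono : ∀ i j : ℤ, i ≤ j → i * L ≤ j * L := fun i j hij =>
      mul_le_mul_of_nonneg_right hij (by omega)
    have hj₁L := hmono _ _ hj₁
    have hj₂L := hmono _ _ hj₂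
    have key : ∀ d, c ≤ d → d + s ≤ c + N * L → (d + s ≤ 0 ∨ L ≤ d) →
        (d + s ≤ N * L + L ∨ (N * L + N * L + L ≤ d) ∨
          (N * L + j₀ * L ≤ d ∧ d + s ≤ N * L + j₀ * L + L)) → False := by
      intro d h1 h2 h3 h4
      refine false_of_axis_gap hE d (hseg d h1 h2) (by rwa [hL]) ?_
      intro j hj1 hj2 hj
      rw [hL, add_mul]
      have a1 := hmono _ _ hj1
      have a2 := hmono _ _ hj2
      rcases lt_or_gt_of_ne hj with hlt | hlt
      · have a3 := hmono (j + 1) j₀ (by omega)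
        rw [add_mul] at a3
        omega
      · have a3 := hmono (j₀ + 1) j (by omega)
        rw [add_mul] at a3
        omega
    by_cases c1 : c ≤ -s
    · exact key c (by omega) (by omega) (by omega) (by omega)
    by_cases c2 : c < N * L + s
    · exact key (max c L) (by omega) (by omega) (by omega) (by omega)
    by_cases c3 : c ≤ N * L + j₀ * L + L - s
    · exact key (max c (N * L + j₀ * L)) (by omega) (by omega) (by omega) (by omega)
    · exact key (max c (N * L + N * L + L)) (by omega) (by omega) (by omega) (by omega)
  · exact not_segment_subset_of_pos hs hE (c := c) (b := b) (by omega) fun x h1 h2 =>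
      mem_of_mem_barrier (h x h1 (by omega)) hb

/-- The only translate of `W` in the part of the barrier above the axis is `W` itself. -/
lemma eq_zero_of_translate_subset_barrier {N s : ℕ} (hN : 4 ≤ N) (hs : 4 ≤ s) {Z : Finset Site}
    (hE : (Z \ Wset s).card < s) {j₀ : ℤ} {q : Site} (hq : 0 ≤ q.2)
    (h : ∀ w ∈ Wset s, q + w ∈ barrier N s Z j₀) : q = (0, 0) := by
  obtain ⟨a, b⟩ := q
  simp only at hq
  have hs' : (4 : ℤ) ≤ s := by exact_mod_cast hs
  have hsL : 4 * (s : ℤ) ≤ (s : ℤ) ^ 2 := by nlinarith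
  have hNL : 4 * (s : ℤ) ^ 2 ≤ N * (s : ℤ) ^ 2 := by
    gcongr; exact_mod_cast hN
  have h0 : ∀ x : ℤ, 1 ≤ x → x ≤ (s : ℤ) ^ 2 → ((a + x, b) : Site) ∈ barrier N s Z j₀ := by
    intro x h1 h2
    simpa using h (x, 0) (mem_Wset.2 (Or.inl ⟨rfl, h1, h2⟩))
  rcases hq.eq_or_lt with rfl | hb
  · have h1 : ∀ l : ℤ, 1 ≤ l → l ≤ s → ((a + l * s, 1) : Site) ∈ Z := by
      intro l hl1 hl2
      refine mem_of_mem_barrier (N := N) (s := s) (j₀ := j₀) ?_ one_pos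
      simpa using h (l * s, 1) (mem_Wset.2 (Or.inr ⟨rfl, l, hl1, hl2, rfl⟩))
    have row1 : (∀ l l' : ℤ, 1 ≤ l → l ≤ s → 1 ≤ l' → l' ≤ s → a + l * s ≠ l' * s) → False := by
      intro hne
      refine false_of_extra_sites hE (fun n => (a + ((n : ℤ) + 1) * s, 1)) ?_ ?_ ?_
      · intro m n hmn
        simp only [Prod.mk.injEq, and_true, add_right_inj] at hmn
        have := mul_right_cancel₀ (by omega : (s : ℤ) ≠ 0) hmn
        omega
      · exact fun n hn => h1 _ (by omega) (by omega)
      · intro n hn hmem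
        rcases mem_Wset.1 hmem with ⟨h2, -⟩ | ⟨-, l', h2, h3, h4⟩
        · simp at h2
        · exact hne _ l' (by omega) (by omega) h2 h3 h4
    have row0 : ∀ d, a ≤ d → d + s ≤ a + (s : ℤ) ^ 2 → (d + s ≤ 0 ∨ (s : ℤ) ^ 2 ≤ d) →
        d + s ≤ N * (s : ℤ) ^ 2 → False := by
      intro d h2 h3 h4 h5
      refine false_of_axis_gap (N := N) (j₀ := j₀) hE d ?_ h4 ?_
      · intro x hx1 hx2
        have := h0 (x - a) (by omega) (by omega)
        rwa [add_sub_cancel] at this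
      · intro j hj1 _ _
        left
        have : 0 ≤ j * (s : ℤ) ^ 2 := by positivity
        rw [add_mul]
        omega
    have ha : a = 0 := by
      by_contra ha
      by_cases c1 : (s : ℤ) ^ 2 ≤ a ∨ a ≤ -(s : ℤ) ^ 2
      · refine row1 fun l l' k1 k2 k3 k4 k5 => ?_
        have e1 : (s : ℤ) ≤ l * s := by nlinarith
        have e2 : l * s ≤ (s : ℤ) ^ 2 := by nlinarith
        have e3 : (s : ℤ) ≤ l' * s := by nlinarith
        have e4 : l' * s ≤ (s : ℤ) ^ 2 := by nlinarith
        omega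
      by_cases c2 : (s : ℤ) ≤ a
      · exact row0 ((s : ℤ) ^ 2) (by omega) (by omega) (by omega) (by omega)
      by_cases c3 : a ≤ -(s : ℤ)
      · exact row0 (-s) (by omega) (by omega) (by omega) (by omega)
      · refine row1 fun l l' _ _ _ _ k5 => ha ?_
        refine Int.eq_zero_of_abs_lt_dvd (m := s) ⟨l' - l, by linarith⟩ ?_
        rw [abs_lt]
        omega
    rw [ha]
  · exact (not_segment_subset_of_pos hs hE (c := a) (b := b) (by omega) fun x h1 h2 =>
      mem_of_mem_barrier (h0 x h1 h2) hb).elim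

lemma barrier_closed {N s : ℕ} (hN : 4 ≤ N) (hs : 4 ≤ s) {S : ℕ → Finset ℕ} {Z : Finset Site}
    (hE : (Z \ Wset s).card < s) {j₀ : ℕ} (hj₁ : 1 ≤ j₀) (hj₂ : j₀ ≤ N)
    (hj₀ : ∀ i ∈ Finset.Icc 1 s, (((i * s : ℕ) : ℤ), (2 : ℤ)) ∈ Z → j₀ ∉ S i)
    (x : Site) (U : Finset Site) (hU : U ∈ famS N s S)
    (h : ∀ y ∈ U, x + y ∈ barrier N s Z j₀) : x ∈ barrier N s Z j₀ := by
  rcases lt_or_ge x.2 0 with hx | hx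
  · exact Or.inl hx
  obtain ⟨a, b⟩ := x
  simp only at hx
  have segment := fun c => not_segment_subset_barrier hN hs hE (j₀ := j₀) (c := c)
    (by exact_mod_cast hj₁) (by exact_mod_cast hj₂) hx
  simp only [famS, Finset.mem_union, Finset.mem_insert, Finset.mem_singleton, Finset.mem_image,
    Finset.mem_filter, Finset.mem_product, Finset.mem_Icc, Prod.exists] at hU
  rcases hU with (rfl | rfl) | ⟨i, j, k, ⟨⟨⟨hi1, hi2⟩, ⟨hj1, hj2⟩, hk1, hk2⟩, hij⟩, rfl⟩
  · refine (segment (a - N * (s : ℤ) ^ 2 - 1) fun y hy1 hy2 => ?_).elim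
    obtain ⟨n, hn⟩ := Int.eq_ofNat_of_zero_le (a := N * (s : ℤ) ^ 2 + 1 - y) (by omega)
    have := h (-(n : ℤ), 0) (Finset.mem_union_left _ (Finset.mem_image.2
      ⟨_, mem_natCast_lift.2 ⟨n, Finset.mem_Icc.2 ⟨by omega, by zify; omega⟩, rfl⟩, rfl⟩))
    rw [Prod.mk_add_mk, add_zero] at this
    convert this using 2
    omega
  · refine (segment a fun y hy1 hy2 => ?_).elim
    obtain ⟨n, rfl⟩ := Int.eq_ofNat_of_zero_le (a := y) (by omega)
    simpa using h ((n : ℤ), 0) (Finset.mem_union_left _ (Finset.mem_image.2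
      ⟨_, mem_natCast_lift.2 ⟨n, Finset.mem_Icc.2 ⟨by omega, by zify; omega⟩, rfl⟩, rfl⟩))
  · have h' : ∀ w ∈ Wset s ∪ {(((i * s : ℕ) : ℤ), (2 : ℤ))},
        ((a - ((k + (N + j) * s ^ 2 : ℕ) : ℤ), b) : Site) + w ∈ barrier N s Z j₀ := by
      intro w hw
      have := h _ (Finset.mem_union_right _ (Finset.mem_image_of_mem _ hw))
      convert this using 1
      ext <;> simp; ring
    have hq := eq_zero_of_translate_subset_barrier hN hs hE hx
      fun w hw => h' w (Finset.mem_union_left _ hw)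
    have hi := h' _ (Finset.mem_union_right _ (Finset.mem_singleton_self _))
    rw [hq, Prod.mk_add_mk, zero_add, zero_add] at hi
    have hne : j ≠ j₀ := by
      rintro rfl
      exact hj₀ i (Finset.mem_Icc.2 ⟨hi1, hi2⟩) (mem_of_mem_barrier hi two_pos) hij
    simp only [Prod.mk.injEq] at hq
    obtain ⟨hq1, rfl⟩ := hq
    push_cast at hq1
    zify at hk1 hk2
    exact Or.inr (Or.inr ⟨rfl, j, by exact_mod_cast hj1, by exact_mod_cast hj2,
      by exact_mod_cast hne, by simp only; omega, by simp only; omega⟩)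

/-- let `u = (0,1)`, `m` the minimum size of a cover, and `Z` a
set of minimum cardinality among sets `Z' ⊆ ℤ² ∖ H_u` with `|Z'| < s² + s + m`
and `Z̄'` infinite, and suppose moreover `W ⊆ Z`.  Then no nonzero translate
`q + W` is contained in `Z̄ = [H_u ∪ Z] ∖ H_u`. -/
theorem famS_no_translate (N s : ℕ) (hN : 4 ≤ N) (hs : 4 ≤ s)
    (S : ℕ → Finset ℕ) (hS : ∀ i ∈ Finset.Icc 1 s, S i ⊆ Finset.Icc 1 N)
    (hcov : (Finset.Icc 1 s).biUnion S = Finset.Icc 1 N)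
    (m : ℕ) (hm : ∃ M : Finset ℕ, IsCover N s S M ∧ M.card = m)
    (hmin : ∀ M : Finset ℕ, IsCover N s S M → m ≤ M.card)
    (Z : Finset Site) (hZ : ∀ z ∈ Z, z ∉ halfPlane ((0 : ℝ), (1 : ℝ)))
    (hZcard : Z.card < s ^ 2 + s + m)
    (hZinf : (bpClosure (famS N s S) (halfPlane ((0 : ℝ), (1 : ℝ)) ∪ (Z : Set Site))
        \ halfPlane ((0 : ℝ), (1 : ℝ))).Infinite)
    (hZmin : ∀ Z' : Finset Site, (∀ z ∈ Z', z ∉ halfPlane ((0 : ℝ), (1 : ℝ))) →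
      Z'.card < s ^ 2 + s + m →
      (bpClosure (famS N s S) (halfPlane ((0 : ℝ), (1 : ℝ)) ∪ (Z' : Set Site))
        \ halfPlane ((0 : ℝ), (1 : ℝ))).Infinite → Z.card ≤ Z'.card)
    (hW : Wset s ⊆ Z) :
    ¬ ∃ q : Site, q ≠ (0, 0) ∧ ∀ w ∈ Wset s,
      q + w ∈ bpClosure (famS N s S) (halfPlane ((0 : ℝ), (1 : ℝ)) ∪ (Z : Set Site))
        \ halfPlane ((0 : ℝ), (1 : ℝ)) := by
  rintro ⟨q, hq0, hq⟩
  have hms : m ≤ s := by simpa using hmin _ ⟨Finset.Subset.refl _, hcov⟩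
  have hE : (Z \ Wset s).card < m := by
    have := Finset.card_le_card hW
    rw [Finset.card_sdiff_of_subset hW]
    rw [card_Wset (by omega)] at *
    omega
  let M := (Finset.Icc 1 s).filter fun i => (((i * s : ℕ) : ℤ), (2 : ℤ)) ∈ Z
  have hMcard : M.card ≤ (Z \ Wset s).card := by
    refine Finset.card_le_card_of_injOn (fun i => (((i * s : ℕ) : ℤ), (2 : ℤ))) ?_ ?_
    · intro i hi
      refine Finset.mem_sdiff.2 ⟨(Finset.mem_filter.1 hi).2, fun h => ?_⟩
      rcases mem_Wset.1 h with ⟨h, -⟩ | ⟨h, -⟩ <;> simp at h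
    · intro i _ i' _ h
      simp only [Prod.mk.injEq, and_true] at h
      exact Nat.eq_of_mul_eq_mul_right (by omega : 0 < s) (by exact_mod_cast h)
  obtain ⟨j₀, hj₀, hj₀M⟩ : ∃ j ∈ Finset.Icc 1 N, j ∉ M.biUnion S := by
    by_contra! hall
    have hsub : M.biUnion S ⊆ Finset.Icc 1 N :=
      Finset.biUnion_subset.2 fun i hi => hS i (Finset.mem_filter.1 hi).1
    have := hmin M ⟨Finset.filter_subset _ _, hsub.antisymm hall⟩
    omega
  rw [Finset.mem_Icc] at hj₀
  have hclosure : bpClosure (famS N s S) (halfPlane ((0 : ℝ), (1 : ℝ)) ∪ (Z : Set Site)) ⊆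
      barrier N s Z j₀ := by
    refine bpClosure_subset ?_ (barrier_closed hN hs (by omega) hj₀.1 hj₀.2 ?_)
    · rintro p (hp | hp)
      · exact Or.inl (mem_halfPlane_up.1 hp)
      · exact Or.inr (Or.inl hp)
    · exact fun i hi hiZ hij =>
        hj₀M (Finset.mem_biUnion.2 ⟨i, Finset.mem_filter.2 ⟨hi, hiZ⟩, hij⟩)
  refine hq0 (eq_zero_of_translate_subset_barrier hN hs (hE.trans_le hms) ?_
    fun w hw => hclosure (hq w hw).1)
  have h := (hq (1, 0) (mem_Wset.2 (Or.inl ⟨rfl, le_rfl, by nlinarith⟩))).2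
  rw [mem_halfPlane_up] at h
  simpa using h
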